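/- Let n be an odd positive integer. The complex vector space of n×n matrices commuting with both S̃ (S̃_{a,b} = n^{-1/2} exp(2πi ab/n)) and T̃² ((T̃²)_{a,b} = δ_{a,b} exp(2πi a²/n)) has dimension equal to the number of divisors of n, and the matrices B̃(d,ℓ) form a basis of it. -/

import Mathlib

open Complex

/-- The 0-1 matrix `B̃(d,ℓ)` indexed by `ℤ/nℤ`. -/
noncomputable def Btilde (n d : ℕ) (ℓ : ℤ) : Matrix (ZMod n) (ZMod n) ℂ :=
  fun a b => if n ∣ d * a.val ∧ (d : ℤ) ∣ ((b.val : ℤ) - (a.val : ℤ) * ℓ) then 1 else 0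

/-- The normalized discrete Fourier transform matrix `S̃`. -/
noncomputable def Stilde (n : ℕ) : Matrix (ZMod n) (ZMod n) ℂ :=
  fun a b => ((n : ℂ) ^ ((1 : ℂ) / 2))⁻¹ *
    Complex.exp (2 * Real.pi * Complex.I * (a.val : ℂ) * (b.val : ℂ) / n)

/-- The diagonal matrix `T̃²`. -/
noncomputable def Ttilde2 (n : ℕ) : Matrix (ZMod n) (ZMod n) ℂ :=
  fun a b => if a = b then Complex.exp (2 * Real.pi * Complex.I * ((a.val : ℂ) ^ 2) / n) else 0

/-- The commutant of `S̃` and `T̃²`, as a subspace of the `n×n` complex matrices. -/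
noncomputable def commutant (n : ℕ) [NeZero n] : Submodule ℂ (Matrix (ZMod n) (ZMod n) ℂ) where
  carrier := {M | M * Stilde n = Stilde n * M ∧ M * Ttilde2 n = Ttilde2 n * M}
  add_mem' := by
    rintro a b ⟨ha1, ha2⟩ ⟨hb1, hb2⟩
    constructor <;> simp only [Matrix.add_mul, Matrix.mul_add, ha1, ha2, hb1, hb2]
  zero_mem' := by
    constructor <;> simp [Matrix.zero_mul, Matrix.mul_zero]
  smul_mem' := by
    rintro c M ⟨h1, h2⟩
    constructor <;> simp only [Matrix.smul_mul, Matrix.mul_smul, h1, h2]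

/-- Index set for the pairs `(d,ℓ)`. -/
def BIndex (n : ℕ) : Type :=
  {p : ℕ × ℤ // p.1 ∣ n ∧ n ∣ p.1 ^ 2 ∧ 0 ≤ p.2 ∧ p.2 < ((p.1 ^ 2 / n : ℕ) : ℤ) ∧
    p.2 ^ 2 ≡ 1 [ZMOD ((p.1 ^ 2 / n : ℕ) : ℤ)]}

section helpers

lemma S_eq (n : ℕ) [NeZero n] (a b : ZMod n) : Stilde n a b =
    ((n : ℂ) ^ ((1 : ℂ) / 2))⁻¹ * ZMod.stdAddChar (a * b) := by
  have h : a * b = (((a.val * b.val : ℕ) : ℤ) : ZMod n) := by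
    push_cast; simp
  rw [h, ZMod.stdAddChar_coe, Stilde]
  congr 2
  push_cast; ring

lemma T_eq (n : ℕ) [NeZero n] : Ttilde2 n =
    Matrix.diagonal (fun a : ZMod n => ZMod.stdAddChar (a * a)) := by
  ext a b
  have h : a * a = (((a.val * a.val : ℕ) : ℤ) : ZMod n) := by
    push_cast; simp
  rw [Matrix.diagonal_apply, h, ZMod.stdAddChar_coe, Ttilde2]
  split_ifs
  · congr 1
    push_cast; ring
  · rfl

lemma comm_S_iff (n : ℕ) [NeZero n] (M : Matrix (ZMod n) (ZMod n) ℂ) :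
    M * Stilde n = Stilde n * M ↔ ∀ a c, ∑ b, M a b * ZMod.stdAddChar (b * c) =
      ∑ b, ZMod.stdAddChar (a * b) * M b c := by
  have hc : ((n : ℂ) ^ ((1 : ℂ) / 2))⁻¹ ≠ 0 := by
    apply inv_ne_zero
    rw [Ne, Complex.cpow_eq_zero_iff]
    simp [NeZero.ne n]
  rw [← Matrix.ext_iff]
  refine forall_congr' fun a => forall_congr' fun c => ?_
  rw [Matrix.mul_apply, Matrix.mul_apply]
  simp only [S_eq]
  rw [← mul_right_inj' hc (b := ∑ b, M a b * ZMod.stdAddChar (b * c)), Finset.mul_sum, Finset.mul_sum]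
  have e1 : ∀ x, M a x * (((n : ℂ) ^ ((1 : ℂ) / 2))⁻¹ * ZMod.stdAddChar (x * c)) =
    ((n : ℂ) ^ ((1 : ℂ) / 2))⁻¹ * (M a x * ZMod.stdAddChar (x * c)) := fun x => by ring
  simp only [e1, mul_assoc]

lemma comm_T_iff (n : ℕ) [NeZero n] (M : Matrix (ZMod n) (ZMod n) ℂ) :
    M * Ttilde2 n = Ttilde2 n * M ↔ ∀ a b, M a b ≠ 0 → a * a = b * b := by
  rw [T_eq, ← Matrix.ext_iff]
  refine forall_congr' fun a => forall_congr' fun b => ?_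
  rw [Matrix.mul_diagonal, Matrix.diagonal_mul, mul_comm]
  constructor
  · intro h h0
    exact (ZMod.injective_stdAddChar (mul_right_cancel₀ h0 h)).symm
  · intro h
    by_cases h0 : M a b = 0
    · simp [h0]
    · rw [h h0]

lemma orth (n : ℕ) [NeZero n] (x : ZMod n) :
    ∑ b : ZMod n, ZMod.stdAddChar (b * x) = if x = 0 then (n : ℂ) else 0 := by
  rw [AddChar.sum_mulShift x (ZMod.isPrimitive_stdAddChar n)]
  simp [ZMod.card]

/-- partial Fourier transform -/
noncomputable def GG (n : ℕ) [NeZero n] (h : ZMod n) (M : Matrix (ZMod n) (ZMod n) ℂ)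
    (s w : ZMod n) : ℂ := ∑ b, M (b + s) b * ZMod.stdAddChar ((b + h * s) * w)

lemma GG_T (n : ℕ) [NeZero n] (h : ZMod n) (hh : 2 * h = 1) (M : Matrix (ZMod n) (ZMod n) ℂ)
    (hM : M * Ttilde2 n = Ttilde2 n * M) (s w : ZMod n) : GG n h M s (w + s) = GG n h M s w := by
  rw [comm_T_iff] at hM
  refine Finset.sum_congr rfl fun b _ => ?_
  by_cases h0 : M (b + s) b = 0
  · simp [h0]
  · have := hM _ _ h0
    congr 2
    linear_combination h * this - b * s * hh

lemma GG_S (n : ℕ) [NeZero n] (h : ZMod n) (hh : 2 * h = 1) (M : Matrix (ZMod n) (ZMod n) ℂ)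
    (hM : M * Stilde n = Stilde n * M) (s w : ZMod n) : GG n h M s w = GG n h M (-w) s := by
  rw [comm_S_iff] at hM
  have hn : (n : ℂ) ≠ 0 := by simp [NeZero.ne n]
  have key : ∀ a c, (n : ℂ) * M a c =
      ∑ y, ∑ x, ZMod.stdAddChar (a * x) * M x y * ZMod.stdAddChar (-(y * c)) := by
    intro a c
    simp_rw [← Finset.sum_mul, ← hM, Finset.sum_mul]
    rw [Finset.sum_comm]
    have : ∀ x y : ZMod n, M a x * ZMod.stdAddChar (x * y) * ZMod.stdAddChar (-(y * c)) =
        M a x * ZMod.stdAddChar (y * (x - c)) := by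
      intro x y
      rw [mul_assoc, ← AddChar.map_add_eq_mul]
      congr 2; ring
    simp_rw [this, ← Finset.mul_sum, orth, sub_eq_zero]
    simp [mul_comm]
  apply mul_left_cancel₀ hn
  unfold GG
  rw [Finset.mul_sum]
  simp_rw [← mul_assoc, key, Finset.sum_mul]
  rw [Finset.sum_comm, Finset.mul_sum]
  refine Finset.sum_congr rfl fun y _ => ?_
  rw [Finset.sum_comm]
  have : ∀ x b : ZMod n, ZMod.stdAddChar ((b + s) * x) * M x y * ZMod.stdAddChar (-(y * b)) *
      ZMod.stdAddChar ((b + h * s) * w) = M x y * ZMod.stdAddChar (s * x + h * s * w) *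
      ZMod.stdAddChar (b * (x - (y - w))) := by
    intro x b
    have e1 : ZMod.stdAddChar ((b + s) * x) * M x y * ZMod.stdAddChar (-(y * b)) *
      ZMod.stdAddChar ((b + h * s) * w) = M x y * (ZMod.stdAddChar ((b + s) * x) * ZMod.stdAddChar (-(y * b)) *
      ZMod.stdAddChar ((b + h * s) * w)) := by ring
    rw [e1, mul_assoc (M x y), ← AddChar.map_add_eq_mul, ← AddChar.map_add_eq_mul,
      ← AddChar.map_add_eq_mul]
    congr 2; ring
  simp_rw [this, ← Finset.mul_sum, orth, sub_eq_zero]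
  simp only [mul_ite, mul_zero, Finset.sum_ite_eq', Finset.mem_univ, if_true]
  have e2 : s * (y - w) + h * s * w = (y + h * -w) * s := by
    linear_combination  s * w * hh
  rw [e2, sub_eq_add_neg]; ring

lemma GG_inj (n : ℕ) [NeZero n] (h : ZMod n) (M : Matrix (ZMod n) (ZMod n) ℂ)
    (hM : ∀ s w, GG n h M s w = 0) : M = 0 := by
  have hn : (n : ℂ) ≠ 0 := by simp [NeZero.ne n]
  ext a c
  have h1 : ∑ w, GG n h M (a - c) w * ZMod.stdAddChar (-((c + h * (a - c)) * w)) = 0 := by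
    simp [hM]
  unfold GG at h1
  simp_rw [Finset.sum_mul] at h1
  rw [Finset.sum_comm] at h1
  have : ∀ b w : ZMod n, M (b + (a - c)) b * ZMod.stdAddChar ((b + h * (a - c)) * w) *
      ZMod.stdAddChar (-((c + h * (a - c)) * w)) = M (b + (a - c)) b *
      ZMod.stdAddChar (w * (b - c)) := by
    intro b w
    rw [mul_assoc, ← AddChar.map_add_eq_mul]
    congr 2; ring
  simp_rw [this, ← Finset.mul_sum, orth, sub_eq_zero] at h1
  simpa [NeZero.ne n] using h1

lemma euclid (n : ℕ) (G : ZMod n → ZMod n → ℂ) (hT : ∀ s w, G s (w + s) = G s w)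
    (hS : ∀ s w, G s w = G (-w) s) (a b : ℕ) : G a b = G (Nat.gcd a b : ℕ) 0 := by
  have hS' : ∀ s w, G s w = G w (-s) := by
    intro s w
    rw [hS s w, hS (-w) s, hS (-s) (-w), neg_neg]
  have hT' : ∀ s w, G (s + w) w = G s w := by
    intro s w
    rw [hS' (s+w) w, hS' s w, ← hT w (-(s+w))]
    congr 1; ring
  induction hk : a + b using Nat.strong_induction_on generalizing a b with
  | _ k ih =>
    rcases Nat.eq_zero_or_pos a with rfl | ha
    · rw [hS']; simp
    rcases Nat.eq_zero_or_pos b with rfl | hb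
    · simp
    rcases le_total a b with hab | hab
    · obtain ⟨c, rfl⟩ := Nat.exists_eq_add_of_le' hab
      have := ih (a + c) (by omega) a c rfl
      rw [Nat.cast_add, hT, this]; simp
    · obtain ⟨c, rfl⟩ := Nat.exists_eq_add_of_le' hab
      have := ih (c + b) (by omega) c b rfl
      rw [Nat.cast_add, hT', this]; simp

/-- evaluation map on the commutant -/
noncomputable def evalG (n : ℕ) [NeZero n] (h : ZMod n) :
    commutant n →ₗ[ℂ] (n.divisors → ℂ) where
  toFun M e := GG n h M.1 ((e : ℕ) : ZMod n) 0
  map_add' M N := by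
    ext e; simp [GG, Finset.sum_add_distrib, add_mul]
  map_smul' c M := by
    ext e; simp [GG, Finset.mul_sum]

lemma evalG_inj (n : ℕ) [NeZero n] (h : ZMod n) (hh : 2 * h = 1) :
    Function.Injective (evalG n h) := by
  rw [injective_iff_map_eq_zero]
  rintro ⟨M, hS, hT⟩ h0
  have h0' : ∀ e ∈ n.divisors, GG n h M (e : ZMod n) 0 = 0 := fun e he =>
    congrFun h0 ⟨e, he⟩
  apply Subtype.ext
  apply GG_inj n h
  intro s w
  have E := euclid n (GG n h M) (GG_T n h hh M hT) (GG_S n h hh M hS)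
  have e1 := E s.val w.val
  have e2 := E (s.val.gcd w.val) n
  simp only [ZMod.natCast_val, ZMod.cast_id', id_eq, ZMod.natCast_self] at e1 e2
  rw [e1, e2]
  exact h0' _ (Nat.mem_divisors.2 ⟨Nat.gcd_dvd_right _ _, NeZero.ne n⟩)

lemma finrank_le (n : ℕ) [NeZero n] (h : ZMod n) (hh : 2 * h = 1) :
    Module.finrank ℂ (commutant n) ≤ n.divisors.card := by
  have := LinearMap.finrank_le_finrank_of_injective (evalG_inj n h hh)
  simpa using this

/-- good basis -/
noncomputable def CC (n e f : ℕ) : Matrix (ZMod n) (ZMod n) ℂ :=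
  fun a b => if (f : ZMod n) * (a - b) = 0 ∧ (e : ZMod n) * (a + b) = 0 then 1 else 0

lemma exists_mul (n e f : ℕ) [NeZero n] (hef : e * f = n) (u : ZMod n) (hu : (f : ZMod n) * u = 0) :
    ∃ t : ZMod n, u = e * t := by
  have hf : 0 < f := Nat.pos_of_ne_zero (by rintro rfl; exact NeZero.ne n (by simpa using hef.symm))
  have h1 : ((f * u.val : ℕ) : ZMod n) = 0 := by push_cast; simpa using hu
  rw [ZMod.natCast_eq_zero_iff] at h1
  have h2 : f * e ∣ f * u.val := by rw [mul_comm f e, hef]; exact h1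
  obtain ⟨t, ht⟩ := (Nat.mul_dvd_mul_iff_left hf).1 h2
  refine ⟨t, ?_⟩
  rw [← Nat.cast_mul, ← ht]; simp

lemma H_orth (n e f : ℕ) [NeZero n] (hef : e * f = n) (v : ZMod n) :
    ∑ k : ZMod n, (if (f : ZMod n) * k = 0 then ZMod.stdAddChar (k * v) else (0:ℂ)) =
      if (e : ZMod n) * v = 0 then ((Finset.univ.filter fun k : ZMod n => (f : ZMod n) * k = 0).card : ℂ)
        else 0 := by
  split_ifs with hv
  · rw [Finset.card_filter]
    push_cast
    refine Finset.sum_congr rfl fun k _ => ?_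
    split_ifs with hk
    · obtain ⟨t, rfl⟩ := exists_mul n e f hef k hk
      rw [show (e : ZMod n) * t * v = t * (e * v) by ring, hv]; simp
    · rfl
  · have hfe : (f : ZMod n) * e = 0 := by
      rw [← Nat.cast_mul, mul_comm, hef]; simp
    set ZZ := ∑ k : ZMod n, (if (f : ZMod n) * k = 0 then ZMod.stdAddChar (k * v) else (0:ℂ)) with hZZ
    have h1 : ZZ = ZMod.stdAddChar ((e : ZMod n) * v) * ZZ := by
      conv_lhs => rw [hZZ, ← Equiv.sum_comp (Equiv.addRight (e : ZMod n))]
      rw [hZZ, Finset.mul_sum]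
      refine Finset.sum_congr rfl fun k _ => ?_
      simp only [Equiv.coe_addRight, mul_add, hfe, add_zero, mul_ite, mul_zero]
      rw [← AddChar.map_add_eq_mul, add_mul, add_comm]
    have h2 : ZMod.stdAddChar ((e : ZMod n) * v) ≠ 1 := by
      intro h
      apply hv
      apply ZMod.injective_stdAddChar
      rw [h, AddChar.map_zero_eq_one]
    have h3 : (ZMod.stdAddChar ((e : ZMod n) * v) - 1) * ZZ = 0 := by
      rw [sub_mul, ← h1]; ring
    rcases mul_eq_zero.1 h3 with h4 | h4
    · exact absurd (sub_eq_zero.1 h4) h2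
    · exact h4

lemma CC_T (n e f : ℕ) [NeZero n] (hef : e * f = n) : CC n e f * Ttilde2 n = Ttilde2 n * CC n e f := by
  rw [comm_T_iff]
  intro a b h
  unfold CC at h
  split_ifs at h with h'
  · obtain ⟨t, ht⟩ := exists_mul n e f hef _ h'.1
    linear_combination (a + b) * ht + t * h'.2
  · exact absurd rfl h

lemma CC_S (n e f : ℕ) [NeZero n] (hef : e * f = n) (h : ZMod n) (hh : 2 * h = 1) :
    CC n e f * Stilde n = Stilde n * CC n e f := by
  rw [comm_S_iff]
  intro a c
  set N : ℂ := ((Finset.univ.filter fun k : ZMod n => (f : ZMod n) * k = 0).card : ℂ) with hN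
  have hN0 : N ≠ 0 := by
    rw [hN, Nat.cast_ne_zero]
    exact Finset.card_ne_zero_of_mem (a := 0) (by simp)
  have key : ∀ a b, N * CC n e f a b = ∑ k : ZMod n, if (f : ZMod n) * k = 0 ∧ (f : ZMod n) * (a - b) = 0 then
      ZMod.stdAddChar (k * (a + b)) else (0 : ℂ) := by
    intro a b
    by_cases h1 : (f : ZMod n) * (a - b) = 0
    · simp only [h1, and_true, H_orth n e f hef, CC, true_and]
      simp [hN]
    · simp [h1, CC]
  have inv2 : ∀ z : ZMod n, (f : ZMod n) * (h * z) = 0 ↔ (f : ZMod n) * z = 0 := by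
    intro z
    constructor
    · intro H; linear_combination 2 * H - f * z * hh
    · intro H; linear_combination h * H
  have inv2' : ∀ z : ZMod n, (f : ZMod n) * (-2 * z) = 0 ↔ (f : ZMod n) * z = 0 := by
    intro z
    constructor
    · intro H; linear_combination (-h) * H - f * z * hh
    · intro H; linear_combination (-2) * H
  apply mul_left_cancel₀ hN0
  rw [Finset.mul_sum, Finset.mul_sum]
  have L : ∀ b, N * (CC n e f a b * ZMod.stdAddChar (b * c)) = ∑ k : ZMod n,
      if (f : ZMod n) * k = 0 ∧ (f : ZMod n) * (a - b) = 0 then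
      ZMod.stdAddChar (k * (a + b) + b * c) else (0 : ℂ) := by
    intro b
    rw [← mul_assoc, key, Finset.sum_mul]
    refine Finset.sum_congr rfl fun k _ => ?_
    split_ifs
    · rw [AddChar.map_add_eq_mul]
    · simp
  have R : ∀ b, N * (ZMod.stdAddChar (a * b) * CC n e f b c) = ∑ k : ZMod n,
      if (f : ZMod n) * k = 0 ∧ (f : ZMod n) * (b - c) = 0 then
      ZMod.stdAddChar (k * (b + c) + a * b) else (0 : ℂ) := by
    intro b
    rw [mul_left_comm, key, Finset.mul_sum]
    refine Finset.sum_congr rfl fun k _ => ?_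
    split_ifs
    · rw [AddChar.map_add_eq_mul, mul_comm]
    · simp
  simp_rw [L, R]
  -- bijection: left (b, k) with k = h * j, b = a + 2 * k' ; right (b = c + j, k')
  rw [Finset.sum_comm, ← Fintype.sum_prod_type', ← Fintype.sum_prod_type']
  let E : ZMod n × ZMod n ≃ ZMod n × ZMod n :=
    { toFun := fun p => (c + 2 * p.1, h * (p.2 - a))
      invFun := fun q => (h * (q.1 - c), a + 2 * q.2)
      left_inv := by
        rintro ⟨x, y⟩
        refine Prod.ext ?_ ?_
        · change h * (c + 2 * x - c) = x
          linear_combination x * hh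
        · change a + 2 * (h * (y - a)) = y
          linear_combination (y - a) * hh
      right_inv := by
        rintro ⟨x, y⟩
        refine Prod.ext ?_ ?_
        · change c + 2 * (h * (x - c)) = x
          linear_combination (x - c) * hh
        · change h * (a + 2 * y - a) = y
          linear_combination y * hh }
  refine Fintype.sum_equiv E _ _ ?_
  rintro ⟨k, b⟩
  change _ = if (f : ZMod n) * (h * (b - a)) = 0 ∧ (f : ZMod n) * (c + 2 * k - c) = 0 then
    ZMod.stdAddChar (h * (b - a) * (c + 2 * k + c) + a * (c + 2 * k)) else (0 : ℂ)
  have c1 : ((f : ZMod n) * k = 0 ∧ (f : ZMod n) * (a - b) = 0) ↔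
      ((f : ZMod n) * (h * (b - a)) = 0 ∧ (f : ZMod n) * (c + 2 * k - c) = 0) := by
    rw [inv2, show c + 2 * k - c = -(-2 * k) by ring, mul_neg, neg_eq_zero, inv2',
      show a - b = -(b - a) by ring, mul_neg, neg_eq_zero, and_comm]
  rw [if_congr c1 _ rfl]
  congr 1
  linear_combination (-(b - a) * (c + k)) * hh

lemma CC_mem (n e f : ℕ) [NeZero n] (hef : e * f = n) (h : ZMod n) (hh : 2 * h = 1) :
    CC n e f ∈ commutant n := ⟨CC_S n e f hef h hh, CC_T n e f hef⟩

lemma CC_li (n : ℕ) [NeZero n] (h : ZMod n) (hh : 2 * h = 1) :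
    LinearIndependent ℂ (fun e : n.divisors => CC n e (n / e)) := by
  rw [Fintype.linearIndependent_iff]
  rintro c hc ⟨e', he'⟩
  have hn := NeZero.ne n
  have hd := (Nat.mem_divisors.1 he').1
  have hM := congrFun (congrFun hc (h * ((e' : ZMod n) + (n / e' : ℕ)))) (h * (((n / e' : ℕ) : ZMod n) - e'))
  rw [Matrix.sum_apply] at hM
  rw [Finset.sum_eq_single ⟨e', he'⟩] at hM
  · have e1 : h * ((e' : ZMod n) + (n / e' : ℕ)) - h * (((n / e' : ℕ) : ZMod n) - e') = e' := by
      linear_combination (e' : ZMod n) * hh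
    have e2 : h * ((e' : ZMod n) + (n / e' : ℕ)) + h * (((n / e' : ℕ) : ZMod n) - e') = (n / e' : ℕ) := by
      linear_combination ((n / e' : ℕ) : ZMod n) * hh
    simp only [Matrix.smul_apply, CC, e1, e2, ← Nat.cast_mul, Nat.div_mul_cancel hd,
      Nat.mul_div_cancel' hd] at hM
    simpa using hM
  · rintro ⟨e, he⟩ _ hne
    have hde := (Nat.mem_divisors.1 he).1
    have e1 : h * ((e' : ZMod n) + (n / e' : ℕ)) - h * (((n / e' : ℕ) : ZMod n) - e') = e' := by
      linear_combination (e' : ZMod n) * hh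
    have e2 : h * ((e' : ZMod n) + (n / e' : ℕ)) + h * (((n / e' : ℕ) : ZMod n) - e') = (n / e' : ℕ) := by
      linear_combination ((n / e' : ℕ) : ZMod n) * hh
    simp only [Matrix.smul_apply, CC, e1, e2, ← Nat.cast_mul, ZMod.natCast_eq_zero_iff]
    rw [if_neg, smul_zero]
    rintro ⟨h1, h2⟩
    apply hne
    apply Subtype.ext
    change e = e'
    obtain ⟨f, hf⟩ := hde
    obtain ⟨f', hf'⟩ := hd
    have pe : 0 < e := Nat.pos_of_ne_zero (by rintro rfl; simp at hf; exact hn hf)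
    have pe' : 0 < e' := Nat.pos_of_ne_zero (by rintro rfl; simp at hf'; exact hn hf')
    have pf : 0 < f := Nat.pos_of_ne_zero (by rintro rfl; simp at hf; exact hn hf)
    have pf' : 0 < f' := Nat.pos_of_ne_zero (by rintro rfl; simp at hf'; exact hn hf')
    have q1 : n / e = f := by rw [hf]; exact Nat.mul_div_cancel_left _ pe
    have q2 : n / e' = f' := by rw [hf']; exact Nat.mul_div_cancel_left _ pe'
    rw [q1] at h1
    rw [q2] at h2
    have d1 : e ∣ e' := by
      apply Nat.dvd_of_mul_dvd_mul_left pf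
      rw [mul_comm f e, ← hf]; exact h1
    have d2 : e' ∣ e := by
      apply Nat.dvd_of_mul_dvd_mul_right pf'
      rw [← hf']; exact h2
    exact Nat.dvd_antisymm d1 d2
  · intro h0; exact absurd (Finset.mem_univ _) h0

end helpers
section helpers2

lemma CC_int (n e f : ℕ) [NeZero n] (hef : e * f = n) (a b : ZMod n) :
    CC n e f a b = if (e : ℤ) ∣ (a.val : ℤ) - b.val ∧ (f : ℤ) ∣ (a.val : ℤ) + b.val then 1 else 0 := by
  have hn := NeZero.ne n
  have he : (e : ℤ) ≠ 0 := by
    rintro h; apply hn; rw [← hef]; have : e = 0 := by exact_mod_cast h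
    simp [this]
  have hf : (f : ℤ) ≠ 0 := by
    rintro h; apply hn; rw [← hef]; have : f = 0 := by exact_mod_cast h
    simp [this]
  have hnz : (n : ℤ) = (e : ℤ) * f := by exact_mod_cast hef.symm
  unfold CC
  refine if_congr (and_congr ?_ ?_) rfl rfl
  · have : (f : ZMod n) * (a - b) = (((f : ℤ) * ((a.val : ℤ) - b.val) : ℤ) : ZMod n) := by
      push_cast; simp
    rw [this, ZMod.intCast_zmod_eq_zero_iff_dvd, hnz, mul_comm (e : ℤ)]
    exact mul_dvd_mul_iff_left hf
  · have : (e : ZMod n) * (a + b) = (((e : ℤ) * ((a.val : ℤ) + b.val) : ℤ) : ZMod n) := by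
      push_cast; simp
    rw [this, ZMod.intCast_zmod_eq_zero_iff_dvd, hnz]
    exact mul_dvd_mul_iff_left he

lemma B_eq_C (n g x y : ℕ) [NeZero n] (hodd : Odd n) (hn : n = g * x * (g * y))
    (hxy : Nat.Coprime x y) (ℓ : ℤ) (hx : (x : ℤ) ∣ ℓ - 1) (hy : (y : ℤ) ∣ ℓ + 1) :
    Btilde n (g * (x * y)) ℓ = CC n (g * x) (g * y) := by
  have hn0 := NeZero.ne n
  have hg : Odd g := by rw [hn, mul_assoc] at hodd; exact (Nat.odd_mul.1 hodd).1
  have hd0 : 0 < g * (x * y) := by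
    apply Nat.pos_of_ne_zero
    intro h
    apply hn0
    rw [hn, show g * x * (g * y) = g * (g * (x * y)) by ring, h, mul_zero]
  have hg0 : (g : ℤ) ≠ 0 := by
    intro h
    have : g = 0 := by exact_mod_cast h
    simp [this] at hd0
  ext a b
  rw [CC_int n _ _ hn.symm, Btilde]
  generalize a.val = a
  generalize b.val = b
  refine if_congr ?_ rfl rfl
  have h1 : n ∣ g * (x * y) * a ↔ (g : ℤ) ∣ a := by
    rw [Int.natCast_dvd_natCast, show n = g * (x * y) * g by rw [hn]; ring]
    exact Nat.mul_dvd_mul_iff_left hd0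
  rw [h1]
  push_cast
  obtain ⟨p, hp⟩ := hx
  obtain ⟨q, hq⟩ := hy
  constructor
  · rintro ⟨⟨a', ha⟩, ⟨t, ht⟩⟩
    constructor
    · refine ⟨-(a' * p) - y * t, ?_⟩
      linear_combination -ht - (a : ℤ) * hp - x * p * ha
    · refine ⟨(a' * q) + x * t, ?_⟩
      linear_combination ht + (a : ℤ) * hq + y * q * ha
  · rintro ⟨⟨s, hs⟩, ⟨t, ht⟩⟩
    have hco : IsCoprime (g : ℤ) 2 := by
      have : Nat.Coprime g 2 := Nat.coprime_two_right.2 hg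
      exact_mod_cast Nat.isCoprime_iff_coprime.2 this
    have ha : (g : ℤ) ∣ a := by
      apply hco.dvd_of_dvd_mul_left
      exact ⟨x * s + y * t, by linear_combination hs + ht⟩
    refine ⟨ha, ?_⟩
    obtain ⟨a', ha⟩ := ha
    obtain ⟨b', hb⟩ : (g : ℤ) ∣ b := ⟨a' - x * s, by linear_combination ha - hs⟩
    have e1 : a' - b' = x * s := by
      apply mul_left_cancel₀ hg0; linear_combination hs - ha + hb
    have e2 : a' + b' = y * t := by
      apply mul_left_cancel₀ hg0; linear_combination ht - ha - hb
    have hco2 : IsCoprime (x : ℤ) (y : ℤ) := Nat.isCoprime_iff_coprime.2 hxy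
    have : (x : ℤ) * y ∣ b' - a' * ℓ := by
      apply hco2.mul_dvd
      · exact ⟨-s - a' * p, by linear_combination -e1 - a' * hp⟩
      · exact ⟨t - a' * q, by linear_combination e2 - a' * hq⟩
    obtain ⟨z, hz⟩ := this
    exact ⟨z, by linear_combination hb - ℓ * ha + g * hz⟩

lemma sq_div (n g m : ℕ) [NeZero n] (hn : n = g * (g * m)) : (g * m) ^ 2 / n = m := by
  have hn0 := NeZero.ne n
  rw [show (g * m) ^ 2 = n * m by rw [hn]; ring]
  exact Nat.mul_div_cancel_left _ (Nat.pos_of_ne_zero hn0)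

lemma exists_p (n : ℕ) [NeZero n] (hodd : Odd n) (e : n.divisors) :
    ∃ p : BIndex n, Btilde n p.1.1 p.1.2 = CC n e (n / e) := by
  obtain ⟨e, he⟩ := e
  obtain ⟨f, hf⟩ := (Nat.mem_divisors.1 he).1
  have hn0 := NeZero.ne n
  have pe : 0 < e := Nat.pos_of_ne_zero (by rintro rfl; simp at hf; exact hn0 hf)
  have q1 : n / e = f := by rw [hf]; exact Nat.mul_div_cancel_left _ pe
  obtain ⟨x, y, hxy, hx, hy⟩ := Nat.exists_coprime e f
  change ∃ p : BIndex n, Btilde n p.1.1 p.1.2 = CC n e (n / e)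
  rw [q1]
  generalize Nat.gcd e f = g at hx hy
  have hn : n = g * x * (g * y) := by rw [hf, hx, hy]; ring
  have hn' : n = g * (g * (x * y)) := by rw [hn]; ring
  have hm0 : x * y ≠ 0 := by
    intro h; apply hn0; rw [hn', h]; simp
  have hco2 : IsCoprime (x : ℤ) (y : ℤ) := Nat.isCoprime_iff_coprime.2 hxy
  obtain ⟨u, v, huv⟩ := hco2
  -- ℓ₀ = 1 - 2 u x = 2 v y - 1
  set l := (1 - 2 * u * x) % ((x * y : ℕ) : ℤ) with hl
  have hmod : ((x * y : ℕ) : ℤ) ∣ (1 - 2 * u * x) - l := Int.dvd_self_sub_emod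
  obtain ⟨k, hk⟩ := hmod
  push_cast at hk
  have hlx : (x : ℤ) ∣ l - 1 := ⟨-2 * u - y * k, by linear_combination -hk⟩
  have hly : (y : ℤ) ∣ l + 1 := ⟨2 * v - x * k, by linear_combination -hk - 2 * huv⟩
  have hs := sq_div n g (x * y) hn'
  refine ⟨⟨(g * (x * y), l), ?_, ?_, ?_, ?_, ?_⟩, ?_⟩
  · exact ⟨g, by rw [hn']; ring⟩
  · exact ⟨x * y, by rw [hn']; ring⟩
  · exact Int.emod_nonneg _ (by exact_mod_cast hm0)
  · simp only [hs]
    exact Int.emod_lt_of_pos _ (by exact_mod_cast Nat.pos_of_ne_zero hm0)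
  · simp only [hs]
    apply Int.ModEq.symm
    rw [Int.modEq_iff_dvd]
    obtain ⟨p, hp⟩ := hlx
    obtain ⟨q, hq⟩ := hly
    exact ⟨p * q, by push_cast; linear_combination (l + 1) * hp + x * p * hq⟩
  · rw [show e = g * x by rw [hx]; ring, show f = g * y by rw [hy]; ring]
    exact B_eq_C n g x y hodd hn hxy l hlx hly

lemma exists_e (n : ℕ) [NeZero n] (hodd : Odd n) (p : BIndex n) :
    ∃ e : n.divisors, Btilde n p.1.1 p.1.2 = CC n e (n / e) := by
  obtain ⟨⟨d, l⟩, hd, hd2, hl0, hl1, hl2⟩ := p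
  simp only at *
  have hn0 := NeZero.ne n
  obtain ⟨g, hg⟩ := hd
  have hd0 : 0 < d := Nat.pos_of_ne_zero (by rintro rfl; simp at hg; exact hn0 hg)
  have hgd : g ∣ d := by
    rw [hg, sq] at hd2
    exact Nat.dvd_of_mul_dvd_mul_left hd0 hd2
  obtain ⟨m, rfl⟩ := hgd
  have hn : n = g * (g * m) := by rw [hg]; ring
  rw [sq_div n g m hn] at hl1 hl2
  have hmodd : Odd m := by
    rw [hn] at hodd; exact (Nat.odd_mul.1 (Nat.odd_mul.1 hodd).2).2
  have hm0 : m ≠ 0 := by rintro rfl; simp at hd0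
  obtain ⟨x, hxdef⟩ : ∃ x, x = Nat.gcd (l - 1).natAbs m := ⟨_, rfl⟩
  obtain ⟨y, hy⟩ : x ∣ m := hxdef ▸ Nat.gcd_dvd_right _ _
  have hx0 : 0 < x := by rw [hxdef]; exact Nat.gcd_pos_of_pos_right _ (Nat.pos_of_ne_zero hm0)
  have hxl : (x : ℤ) ∣ l - 1 := by
    rw [Int.natCast_dvd, hxdef]; exact Nat.gcd_dvd_left _ _
  have hyl : (y : ℤ) ∣ l + 1 := by
    obtain ⟨c, hc⟩ := hxl
    have hcop : Nat.Coprime y c.natAbs := by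
      have h1 : (l - 1).natAbs = x * c.natAbs := by rw [hc, Int.natAbs_mul]; simp
      rw [h1, hy, Nat.gcd_mul_left] at hxdef
      have : Nat.gcd c.natAbs y = 1 := by
        apply Nat.eq_of_mul_eq_mul_left hx0; rw [← hxdef, mul_one]
      rw [Nat.Coprime, Nat.gcd_comm]; exact this
    have hcop' : IsCoprime (y : ℤ) c := by
      rw [Int.isCoprime_iff_gcd_eq_one]; exact hcop
    apply hcop'.dvd_of_dvd_mul_left
    have h2 := (Int.modEq_iff_dvd.1 hl2.symm)
    obtain ⟨k, hk⟩ := h2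
    refine ⟨k, ?_⟩
    have hx0' : (x : ℤ) ≠ 0 := by exact_mod_cast hx0.ne'
    apply mul_left_cancel₀ hx0'
    rw [hy] at hk; push_cast at hk
    linear_combination hk - (l + 1) * hc
  have hxy : Nat.Coprime x y := by
    have hxodd : Odd x := by rw [hy] at hmodd; exact (Nat.odd_mul.1 hmodd).1
    have h1 : ((Nat.gcd x y : ℕ) : ℤ) ∣ 2 := by
      have a1 : ((Nat.gcd x y : ℕ) : ℤ) ∣ l - 1 :=
        (Int.natCast_dvd_natCast.2 (Nat.gcd_dvd_left x y)).trans hxl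
      have a2 : ((Nat.gcd x y : ℕ) : ℤ) ∣ l + 1 :=
        (Int.natCast_dvd_natCast.2 (Nat.gcd_dvd_right x y)).trans hyl
      have := dvd_sub a2 a1
      ring_nf at this
      exact this
    have h2 : Nat.gcd x y ∣ 2 := by exact_mod_cast h1
    have h3 : Nat.Coprime x 2 := Nat.coprime_two_right.2 hxodd
    exact Nat.eq_one_of_dvd_coprimes h3 (Nat.gcd_dvd_left x y) h2
  have hn2 : n = g * x * (g * y) := by rw [hn, hy]; ring
  have hgx : 0 < g * x := Nat.pos_of_ne_zero (by intro h; rw [h] at hn2; simp at hn2; exact hn0 hn2)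
  refine ⟨⟨g * x, Nat.mem_divisors.2 ⟨⟨_, hn2⟩, hn0⟩⟩, ?_⟩
  have q1 : n / (g * x) = g * y := by
    conv_lhs => rw [hn2]
    exact Nat.mul_div_cancel_left _ hgx
  change _ = CC n (g * x) (n / (g * x))
  rw [q1, ← B_eq_C n g x y hodd hn2 hxy l hxl hyl, hy]

lemma B_supp (n d : ℕ) [NeZero n] (l : ℤ) (a b : ℕ) (hd : d ∣ n) :
    Btilde n d l (a : ZMod n) (b : ZMod n) ≠ 0 ↔ n ∣ d * a ∧ (d : ℤ) ∣ (b : ℤ) - a * l := by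
  unfold Btilde
  have h1 : n ∣ d * ((a : ZMod n)).val ↔ n ∣ d * a := by
    rw [← ZMod.natCast_eq_zero_iff, ← ZMod.natCast_eq_zero_iff]
    push_cast; simp
  have h2 : (d : ℤ) ∣ ((b : ZMod n).val : ℤ) - ((a : ZMod n).val : ℤ) * l ↔
      (d : ℤ) ∣ (b : ℤ) - a * l := by
    have ea : ((((a : ZMod n).val : ℤ)) : ZMod d) = a := by
      rw [ZMod.val_natCast]
      have : ((a % n : ℕ) : ZMod d) = a := by
        rw [ZMod.natCast_eq_natCast_iff]
        exact (Nat.mod_modEq a n).of_dvd hd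
      exact_mod_cast this
    have eb : ((((b : ZMod n).val : ℤ)) : ZMod d) = b := by
      rw [ZMod.val_natCast]
      have : ((b % n : ℕ) : ZMod d) = b := by
        rw [ZMod.natCast_eq_natCast_iff]
        exact (Nat.mod_modEq b n).of_dvd hd
      exact_mod_cast this
    rw [← ZMod.intCast_zmod_eq_zero_iff_dvd, ← ZMod.intCast_zmod_eq_zero_iff_dvd,
      Int.cast_sub, Int.cast_mul, ea, eb]
    push_cast; rfl
  rw [← h1, ← h2]
  split_ifs with h
  · exact ⟨fun _ => h, fun _ => one_ne_zero⟩
  · exact ⟨fun h0 => absurd rfl h0, fun h0 => absurd h0 h⟩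

lemma B_inj (n : ℕ) [NeZero n] :
    Function.Injective (fun p : BIndex n => Btilde n p.1.1 p.1.2) := by
  rintro ⟨⟨d, l⟩, hd, hd2, hl0, hl1, hl2⟩ ⟨⟨d', l'⟩, hd', hd2', hl0', hl1', hl2'⟩ h
  simp only at *
  have hn0 := NeZero.ne n
  obtain ⟨g, hg⟩ := hd
  obtain ⟨g', hg'⟩ := hd'
  have key : ∀ (a b : ℕ), (n ∣ d * a ∧ (d : ℤ) ∣ (b : ℤ) - a * l) ↔
      (n ∣ d' * a ∧ (d' : ℤ) ∣ (b : ℤ) - a * l') := by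
    intro a b
    rw [← B_supp n d l a b ⟨g, hg⟩, ← B_supp n d' l' a b ⟨g', hg'⟩, h]
  have hg0 : 0 < g := Nat.pos_of_ne_zero (by rintro rfl; simp at hg; exact hn0 hg)
  have hg0' : 0 < g' := Nat.pos_of_ne_zero (by rintro rfl; simp at hg'; exact hn0 hg')
  obtain ⟨c, rfl⟩ := Int.eq_ofNat_of_zero_le hl0
  obtain ⟨c', rfl⟩ := Int.eq_ofNat_of_zero_le hl0'
  have k1 := (key g (g * c)).1 ⟨by rw [hg], by push_cast; simp⟩
  have k2 := (key g' (g' * c')).2 ⟨by rw [hg'], by push_cast; simp⟩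
  have d1 : d ∣ d' := by
    apply Nat.dvd_of_mul_dvd_mul_right hg0; rw [← hg]; exact k1.1
  have d2 : d' ∣ d := by
    apply Nat.dvd_of_mul_dvd_mul_right hg0'; rw [← hg']; exact k2.1
  obtain rfl := Nat.dvd_antisymm d1 d2
  have hd0 : 0 < d := Nat.pos_of_ne_zero (by rintro rfl; simp at hg; exact hn0 hg)
  have hgd : g ∣ d := by
    rw [hg, sq] at hd2
    exact Nat.dvd_of_mul_dvd_mul_left hd0 hd2
  obtain ⟨m, rfl⟩ := hgd
  have hn : n = g * (g * m) := by rw [hg]; ring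
  rw [sq_div n g m hn] at hl1 hl1'
  have k3 : (m : ℤ) ∣ (c : ℤ) - c' := by
    have hgz : (g : ℤ) ≠ 0 := by exact_mod_cast hg0.ne'
    rw [← mul_dvd_mul_iff_left hgz]
    have := k1.2
    push_cast at this
    rw [mul_sub]; exact this
  have k4 : (c' : ℤ) = c := by
    have := Int.ModEq.eq (Int.modEq_iff_dvd.2 k3)
    rwa [Int.emod_eq_of_lt hl0 hl1, Int.emod_eq_of_lt hl0' hl1'] at this
  apply Subtype.ext
  change (g * m, (c : ℤ)) = (g * m, (c' : ℤ))
  rw [k4]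

end helpers2

/-- Lemma 4.1(a): the commutant of `S̃` and `T̃²` has dimension the number of
divisors of `n`, and the matrices `B̃(d,ℓ)` form a basis of it. -/
theorem commutant_dim_and_basis (n : ℕ) [NeZero n] (hodd : Odd n) (hpos : 0 < n) :
    Module.finrank ℂ (commutant n) = n.divisors.card ∧
    (∀ p : BIndex n, Btilde n p.1.1 p.1.2 ∈ commutant n) ∧
    LinearIndependent ℂ (fun p : BIndex n => Btilde n p.1.1 p.1.2) ∧
    Submodule.span ℂ (Set.range fun p : BIndex n => Btilde n p.1.1 p.1.2) = commutant n := by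
  obtain ⟨h, hh⟩ : ∃ h : ZMod n, 2 * h = 1 := by
    refine ⟨((2 : ℕ) : ZMod n)⁻¹, ?_⟩
    have := ZMod.coe_mul_inv_eq_one (n := n) 2 (Nat.coprime_two_left.2 hodd)
    exact_mod_cast this
  choose P hP using exists_p n hodd
  have hli := CC_li n h hh
  have hPbij : Function.Bijective P := by
    constructor
    · intro e e' hee
      apply hli.injective
      change CC n e (n / e) = CC n e' (n / e')
      rw [← hP, ← hP, hee]
    · intro p
      obtain ⟨e, he⟩ := exists_e n hodd p
      refine ⟨e, B_inj n ?_⟩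
      change Btilde n (P e).1.1 (P e).1.2 = Btilde n p.1.1 p.1.2
      rw [hP, he]
  have hcomp : (fun p : BIndex n => Btilde n p.1.1 p.1.2) ∘ (Equiv.ofBijective P hPbij) =
      fun e : n.divisors => CC n e (n / e) := by
    funext e; exact hP e
  have hB : LinearIndependent ℂ (fun p : BIndex n => Btilde n p.1.1 p.1.2) := by
    rw [← linearIndependent_equiv (Equiv.ofBijective P hPbij), hcomp]
    exact hli
  have hmem : ∀ p : BIndex n, Btilde n p.1.1 p.1.2 ∈ commutant n := by
    intro p
    obtain ⟨e, he⟩ := exists_e n hodd p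
    rw [he]
    exact CC_mem n _ _ (Nat.mul_div_cancel' (Nat.mem_divisors.1 e.2).1) h hh
  have hle : Submodule.span ℂ (Set.range fun p : BIndex n => Btilde n p.1.1 p.1.2) ≤ commutant n := by
    rw [Submodule.span_le]
    rintro _ ⟨p, rfl⟩
    exact hmem p
  have hfr : Module.finrank ℂ
      (Submodule.span ℂ (Set.range fun p : BIndex n => Btilde n p.1.1 p.1.2)) = n.divisors.card := by
    have hr : (Set.range fun p : BIndex n => Btilde n p.1.1 p.1.2) =
        Set.range fun e : n.divisors => CC n e (n / e) := by
      rw [← hcomp, EquivLike.range_comp]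
    rw [hr, finrank_span_eq_card hli]
    simp
  have hup := finrank_le n h hh
  have hspan := Submodule.eq_of_le_of_finrank_le hle (by rw [hfr]; exact hup)
  exact ⟨by rw [← hspan, hfr], hmem, hB, hspan⟩
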